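/- Let V = [[A,C],[Cᵀ,B]] be a physical covariance matrix of a two-mode Gaussian state with det A = det B (a symmetric state). Then there exist S_a, S_b ∈ Sp(2,ℝ) such that the locally transformed matrix V' = (S_a ⊕ S_b) V (S_a ⊕ S_b)ᵀ achieves the upper bound of the coherent-state teleportation fidelity: F(V') = 1/(1 + ν(V)). -/

import Mathlib

open Matrix
open scoped ComplexOrder

noncomputable section

/-- The 2×2 symplectic form `J = [[0,1],[-1,0]]`. -/
def J2 : Matrix (Fin 2) (Fin 2) ℝ := !![0, 1; -1, 0]

/-- `Z = diag(1,-1)`. -/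
def Z2 : Matrix (Fin 2) (Fin 2) ℝ := !![1, 0; 0, -1]

/-- The 4×4 symplectic form `Ω = diag(J, J)`. -/
def Ω4 : Matrix (Fin 2 ⊕ Fin 2) (Fin 2 ⊕ Fin 2) ℝ := fromBlocks J2 0 0 J2

/-- `V` is a physical covariance matrix of a two-mode Gaussian state: `V + iΩ` is
positive semidefinite. -/
def IsPhysCM (V : Matrix (Fin 2 ⊕ Fin 2) (Fin 2 ⊕ Fin 2) ℝ) : Prop :=
  (V.map Complex.ofReal + Complex.I • Ω4.map Complex.ofReal).PosSemidef

/-- Noise matrix `N(V) = Z A Z + Z C + Cᵀ Z + B` of a two-mode covariance matrix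
`V = [[A, C], [Cᵀ, B]]`. -/
def noiseN (V : Matrix (Fin 2 ⊕ Fin 2) (Fin 2 ⊕ Fin 2) ℝ) : Matrix (Fin 2) (Fin 2) ℝ :=
  Z2 * V.toBlocks₁₁ * Z2 + Z2 * V.toBlocks₁₂ + (V.toBlocks₁₂)ᵀ * Z2 + V.toBlocks₂₂

/-- Coherent-state teleportation fidelity `F(V) = 2 / √(det (2 I₂ + N(V)))`. -/
def fid (V : Matrix (Fin 2 ⊕ Fin 2) (Fin 2 ⊕ Fin 2) ℝ) : ℝ :=
  2 / Real.sqrt (((2 : ℝ) • (1 : Matrix (Fin 2) (Fin 2) ℝ) + noiseN V).det)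

/-- `Σ(V) = det A + det B - 2 det C`. -/
def SigmaPT (V : Matrix (Fin 2 ⊕ Fin 2) (Fin 2 ⊕ Fin 2) ℝ) : ℝ :=
  (V.toBlocks₁₁).det + (V.toBlocks₂₂).det - 2 * (V.toBlocks₁₂).det

/-- The lowest partially-transposed symplectic eigenvalue
`ν(V) = √((Σ − √(Σ² − 4 det V))/2)`. -/
def nuPT (V : Matrix (Fin 2 ⊕ Fin 2) (Fin 2 ⊕ Fin 2) ℝ) : ℝ :=
  Real.sqrt ((SigmaPT V - Real.sqrt ((SigmaPT V) ^ 2 - 4 * V.det)) / 2)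

theorem mul_J2_mul_transpose_eq {S : Matrix (Fin 2) (Fin 2) ℝ} (hS : S.det = 1) :
    S * J2 * Sᵀ = J2 := by
  rw [det_fin_two] at hS
  ext i j
  fin_cases i <;> fin_cases j <;> simp [J2, Matrix.mul_apply, Fin.sum_univ_two] <;> linarith

theorem Z2_mul_self : Z2 * Z2 = 1 := by
  ext i j
  fin_cases i <;> fin_cases j <;> simp [Z2, Matrix.mul_apply, Fin.sum_univ_two]

theorem Z2_transpose : Z2ᵀ = Z2 := by
  ext i j
  fin_cases i <;> fin_cases j <;> simp [Z2]

theorem Z2_det : Z2.det = -1 := by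
  simp [Z2, det_fin_two]

/-- A positive definite `2 × 2` matrix is brought to a multiple of the identity by a
symplectic congruence (Williamson's theorem for one mode). -/
theorem exists_det_one_congr_eq_smul_one {M : Matrix (Fin 2) (Fin 2) ℝ} (hM : M.PosDef) :
    ∃ T : Matrix (Fin 2) (Fin 2) ℝ, T.det = 1 ∧ T * M * Tᵀ = Real.sqrt M.det • 1 := by
  have hd := hM.det_pos
  have h0 : 0 < M 0 0 := hM.diag_pos
  have hs : M 1 0 = M 0 1 := by simpa using hM.isHermitian.apply 0 1
  obtain ⟨d, hdpos, hdM⟩ : ∃ d, 0 < d ∧ d ^ 2 = Real.sqrt M.det :=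
    ⟨√(√M.det), by positivity, Real.sq_sqrt (Real.sqrt_nonneg _)⟩
  obtain ⟨m, hm, hmM⟩ : ∃ m, 0 < m ∧ m ^ 2 = M 0 0 :=
    ⟨√(M 0 0), by positivity, Real.sq_sqrt h0.le⟩
  have hd4 : d ^ 4 = M 0 0 * M 1 1 - M 0 1 * M 0 1 := by
    have : d ^ 4 = (d ^ 2) ^ 2 := by ring
    rw [this, hdM, Real.sq_sqrt hd.le, det_fin_two, hs]
  have h11 : M 1 1 = (d ^ 4 + M 0 1 * M 0 1) / m ^ 2 := by
    rw [hd4, hmM]; field_simp; ring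
  refine ⟨!![d / m, 0; -(M 0 1) / (m * d), m / d], ?_, ?_⟩
  · rw [det_fin_two_of]; field_simp; ring
  · rw [← hdM]
    ext i j
    fin_cases i <;> fin_cases j <;>
      simp [Matrix.mul_apply, vecMul, dotProduct, Fin.sum_univ_two, hs, h11, ← hmM,
        -mul_eq_zero] <;>
      field_simp <;> ring

/-- A rotation making the traceless symmetric part of a real `2 × 2` matrix diagonal, with the
smaller diagonal entry first. -/
theorem exists_rotation_mul (C : Matrix (Fin 2) (Fin 2) ℝ) :
    ∃ R : Matrix (Fin 2) (Fin 2) ℝ, R.det = 1 ∧ R * Rᵀ = 1 ∧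
      (R * C) 1 0 = -(R * C) 0 1 ∧ (R * C) 0 0 ≤ (R * C) 1 1 := by
  obtain ⟨c, s, h1, h2, h3⟩ : ∃ c s : ℝ, c ^ 2 + s ^ 2 = 1 ∧
      c * (C 0 1 + C 1 0) = s * (C 0 0 - C 1 1) ∧
      c * (C 0 0 - C 1 1) + s * (C 0 1 + C 1 0) ≤ 0 := by
    generalize C 0 0 - C 1 1 = x
    generalize C 0 1 + C 1 0 = y
    by_cases h : x ^ 2 + y ^ 2 = 0
    · have hx : x = 0 := by nlinarith [sq_nonneg x, sq_nonneg y]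
      have hy : y = 0 := by nlinarith [sq_nonneg x, sq_nonneg y]
      exact ⟨1, 0, by norm_num, by simp [hy], by simp [hx]⟩
    · have hp : 0 < x ^ 2 + y ^ 2 := lt_of_le_of_ne (by positivity) (Ne.symm h)
      obtain ⟨w, hw, hww⟩ : ∃ w, 0 < w ∧ w ^ 2 = x ^ 2 + y ^ 2 :=
        ⟨√(x ^ 2 + y ^ 2), by positivity, Real.sq_sqrt hp.le⟩
      refine ⟨-x / w, -y / w, ?_, ?_, ?_⟩
      · field_simp; linarith
      · ring
      · have : -x / w * x + -y / w * y = -(w ^ 2) / w := by rw [hww]; ring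
        rw [this, neg_div]
        exact neg_nonpos.2 (by positivity)
  refine ⟨!![c, s; -s, c], ?_, ?_, ?_, ?_⟩
  · rw [det_fin_two_of]; linarith
  · ext i j
    fin_cases i <;> fin_cases j <;> simp [Matrix.mul_apply, Fin.sum_univ_two] <;> linarith
  · simp [Matrix.mul_apply, Fin.sum_univ_two]; linarith
  · simp [Matrix.mul_apply, Fin.sum_univ_two]; linarith

/-- Physical covariance matrices are positive definite. -/
theorem IsPhysCM.posDef {V : Matrix (Fin 2 ⊕ Fin 2) (Fin 2 ⊕ Fin 2) ℝ} (hV : IsPhysCM V) :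
    V.PosDef := by
  unfold IsPhysCM at hV
  have hmul (x : Fin 2 ⊕ Fin 2 → ℝ) (i : Fin 2 ⊕ Fin 2) :
      ((V.map Complex.ofReal + Complex.I • Ω4.map Complex.ofReal) *ᵥ (fun j => (x j : ℂ))) i
        = ((V *ᵥ x) i : ℂ) + Complex.I * ((Ω4 *ᵥ x) i : ℂ) := by
    simp [Matrix.mulVec, dotProduct, Finset.sum_add_distrib, add_mul]
    ring
  have hskew (x : Fin 2 ⊕ Fin 2 → ℝ) : x ⬝ᵥ (Ω4 *ᵥ x) = 0 := by
    simp [Ω4, J2, Matrix.mulVec, dotProduct, Fin.sum_univ_two]; ring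
  have hform (x : Fin 2 ⊕ Fin 2 → ℝ) :
      star (fun j => (x j : ℂ)) ⬝ᵥ
        ((V.map Complex.ofReal + Complex.I • Ω4.map Complex.ofReal) *ᵥ (fun j => (x j : ℂ)))
        = ((x ⬝ᵥ (V *ᵥ x) : ℝ) : ℂ) := by
    have h : ((x ⬝ᵥ (V *ᵥ x) : ℝ) : ℂ) =
        ((x ⬝ᵥ (V *ᵥ x) : ℝ) : ℂ) + Complex.I * ((x ⬝ᵥ (Ω4 *ᵥ x) : ℝ) : ℂ) := by
      rw [hskew]; simp
    rw [h]
    simp only [dotProduct, hmul, Pi.star_apply, Complex.star_def, Complex.conj_ofReal,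
      Complex.ofReal_sum, Complex.ofReal_mul, Finset.mul_sum, ← Finset.sum_add_distrib]
    exact Finset.sum_congr rfl fun i _ => by ring
  refine PosDef.of_dotProduct_mulVec_pos ?_ fun x hx => ?_
  · ext i j
    have h := congrArg Complex.re (hV.isHermitian.apply i j)
    simpa using h
  · have hnn := hV.dotProduct_mulVec_nonneg (fun j => (x j : ℂ))
    rw [hform, Complex.zero_le_real] at hnn
    refine lt_of_le_of_ne hnn fun h0 => hx ?_
    have hk := (hV.dotProduct_mulVec_zero_iff (fun j => (x j : ℂ))).1 (by
      rw [hform, Complex.ofReal_eq_zero]; exact h0.symm)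
    have hΩ (i : Fin 2 ⊕ Fin 2) : (Ω4 *ᵥ x) i = 0 := by
      have h := congrArg Complex.im (congrFun hk i)
      rw [hmul] at h
      simpa using h
    have h1 := hΩ (Sum.inl 0)
    have h2 := hΩ (Sum.inl 1)
    have h3 := hΩ (Sum.inr 0)
    have h4 := hΩ (Sum.inr 1)
    simp [Ω4, J2, Matrix.mulVec, dotProduct, Fin.sum_univ_two] at h1 h2 h3 h4
    ext i
    rcases i with i | i <;> fin_cases i <;> simp [h1, h2, h3, h4]

theorem noiseN_fromBlocks (A B C D : Matrix (Fin 2) (Fin 2) ℝ) :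
    noiseN (fromBlocks A C D B) = Z2 * A * Z2 + Z2 * C + Cᵀ * Z2 + B := by
  simp [noiseN]

theorem local_congr_fromBlocks (A B C S T : Matrix (Fin 2) (Fin 2) ℝ) :
    fromBlocks S 0 0 T * fromBlocks A C Cᵀ B * (fromBlocks S 0 0 T)ᵀ =
      fromBlocks (S * A * Sᵀ) (S * C * Tᵀ) (S * C * Tᵀ)ᵀ (T * B * Tᵀ) := by
  simp [fromBlocks_transpose, fromBlocks_multiply, Matrix.mul_assoc]

theorem nuPT_local_congr (A B C : Matrix (Fin 2) (Fin 2) ℝ) {S T : Matrix (Fin 2) (Fin 2) ℝ}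
    (hS : S.det = 1) (hT : T.det = 1) :
    nuPT (fromBlocks (S * A * Sᵀ) (S * C * Tᵀ) (S * C * Tᵀ)ᵀ (T * B * Tᵀ)) =
      nuPT (fromBlocks A C Cᵀ B) := by
  have hdet : (fromBlocks (S * A * Sᵀ) (S * C * Tᵀ) (S * C * Tᵀ)ᵀ (T * B * Tᵀ)).det =
      (fromBlocks A C Cᵀ B).det := by
    rw [← local_congr_fromBlocks, det_mul, det_mul, det_transpose, det_fromBlocks_zero₂₁, hS, hT]
    ring
  simp only [nuPT, SigmaPT, hdet, toBlocks_fromBlocks₁₁, toBlocks_fromBlocks₁₂,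
    toBlocks_fromBlocks₂₂, det_mul, det_transpose, hS, hT, one_mul, mul_one]

theorem posDef_noiseN {V : Matrix (Fin 2 ⊕ Fin 2) (Fin 2 ⊕ Fin 2) ℝ} (hV : V.PosDef) :
    (noiseN V).PosDef := by
  have hsym : V.toBlocks₂₁ = V.toBlocks₁₂ᵀ := by
    ext i j
    exact hV.isHermitian.apply (Sum.inl j) (Sum.inr i)
  obtain ⟨W, hW⟩ : ∃ W : Matrix (Fin 2) (Fin 2 ⊕ Fin 2) ℝ, W = fromCols Z2 1 := ⟨_, rfl⟩
  have hN : noiseN V = W * V * W.conjTranspose := by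
    conv_rhs => rw [← fromBlocks_toBlocks V]
    rw [hW, conjTranspose_eq_transpose_of_trivial, transpose_fromCols,
      fromCols_mul_fromBlocks, fromCols_mul_fromRows, hsym, noiseN, Z2_transpose]
    simp [Matrix.add_mul]
    abel
  rw [hN]
  refine hV.mul_mul_conjTranspose_same fun x y hxy => ?_
  ext i
  simpa [hW] using congrFun hxy (Sum.inr i)

/-- The noise matrix can be made a multiple of the identity by local symplectic operations. -/
theorem exists_local_fid_eq {A B C : Matrix (Fin 2) (Fin 2) ℝ}
    (hN : (noiseN (fromBlocks A C Cᵀ B)).PosDef) :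
    ∃ S T : Matrix (Fin 2) (Fin 2) ℝ, S.det = 1 ∧ T.det = 1 ∧
      fid (fromBlocks (S * A * Sᵀ) (S * C * Tᵀ) (S * C * Tᵀ)ᵀ (T * B * Tᵀ)) =
        2 / (2 + √(noiseN (fromBlocks A C Cᵀ B)).det) := by
  obtain ⟨T, hT, hTN⟩ := exists_det_one_congr_eq_smul_one hN
  refine ⟨Z2 * T * Z2, T, by simp [det_mul, Z2_det, hT], hT, ?_⟩
  have hcov : noiseN (fromBlocks (Z2 * T * Z2 * A * (Z2 * T * Z2)ᵀ) (Z2 * T * Z2 * C * Tᵀ)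
      (Z2 * T * Z2 * C * Tᵀ)ᵀ (T * B * Tᵀ)) = T * noiseN (fromBlocks A C Cᵀ B) * Tᵀ := by
    have hZ (X : Matrix (Fin 2) (Fin 2) ℝ) : Z2 * (Z2 * X) = X := by
      rw [← Matrix.mul_assoc, Z2_mul_self, Matrix.one_mul]
    simp only [noiseN_fromBlocks, transpose_mul, transpose_transpose, Z2_transpose,
      Matrix.mul_assoc, hZ, Z2_mul_self, Matrix.mul_one, Matrix.mul_add, Matrix.add_mul]
  rw [fid, hcov, hTN, ← add_smul, det_smul]
  simp only [Fintype.card_fin, det_one, mul_one]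
  rw [Real.sqrt_sq (by positivity)]

/-- For `A = B = a I` and `C` with diagonal traceless symmetric part, the noise matrix
determines the lowest partially-transposed symplectic eigenvalue. -/
theorem sqrt_det_noiseN_eq {a p q s : ℝ} (ha : 0 < a) (hps : p ≤ s) :
    √(noiseN (fromBlocks (a • 1) !![p, q; -q, s] !![p, q; -q, s]ᵀ (a • 1))).det =
      2 * nuPT (fromBlocks (a • 1) !![p, q; -q, s] !![p, q; -q, s]ᵀ (a • 1)) := by
  have hN : (noiseN (fromBlocks (a • 1) !![p, q; -q, s] !![p, q; -q, s]ᵀ (a • 1))).det =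
      2 ^ 2 * ((a + p) * (a - s) - q ^ 2) := by
    rw [noiseN_fromBlocks, det_fin_two]
    simp [Z2, Matrix.mul_apply, Fin.sum_univ_two]
    ring
  have hSigma : SigmaPT (fromBlocks (a • 1) !![p, q; -q, s] !![p, q; -q, s]ᵀ (a • 1)) =
      2 * a ^ 2 - 2 * (p * s + q ^ 2) := by
    simp [SigmaPT, det_fin_two]
    ring
  have hdet : (fromBlocks (a • 1) !![p, q; -q, s] !![p, q; -q, s]ᵀ (a • 1)).det =
      (a ^ 2 - p ^ 2 - q ^ 2) * (a ^ 2 - s ^ 2 - q ^ 2) - (q * (s - p)) ^ 2 := by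
    let inv : Invertible (a • (1 : Matrix (Fin 2) (Fin 2) ℝ)) :=
      ⟨a⁻¹ • 1, by simp [smul_smul, ha.ne'], by simp [smul_smul, ha.ne']⟩
    have hinv : ⅟(a • (1 : Matrix (Fin 2) (Fin 2) ℝ)) = a⁻¹ • 1 := rfl
    rw [det_fromBlocks₁₁, hinv, det_fin_two, det_fin_two]
    simp [Matrix.mul_apply, Fin.sum_univ_two]
    field_simp
    ring
  have hdisc : (2 * a ^ 2 - 2 * (p * s + q ^ 2)) ^ 2 -
      4 * ((a ^ 2 - p ^ 2 - q ^ 2) * (a ^ 2 - s ^ 2 - q ^ 2) - (q * (s - p)) ^ 2) =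
        (2 * a * (s - p)) ^ 2 := by
    ring
  rw [nuPT, hSigma, hdet, hN, Real.sqrt_mul (by norm_num), Real.sqrt_sq (by norm_num), hdisc,
    Real.sqrt_sq (mul_nonneg (by positivity) (by linarith))]
  congr 2
  ring

/-- if `V = [[A,C],[Cᵀ,B]]` is a physical two-mode covariance matrix with
`det A = det B` (a symmetric state), then local symplectic operations `Sa, Sb ∈ Sp(2,ℝ)`
achieve the upper fidelity bound `F(V') = 1/(1 + ν(V))`. -/
theorem fidelity_upper_bound_achieved_symmetric
    (A B C : Matrix (Fin 2) (Fin 2) ℝ)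
    (hV : IsPhysCM (fromBlocks A C Cᵀ B)) (hsym : A.det = B.det) :
    ∃ Sa Sb : Matrix (Fin 2) (Fin 2) ℝ,
      Sa * J2 * Saᵀ = J2 ∧ Sb * J2 * Sbᵀ = J2 ∧
      fid (fromBlocks Sa 0 0 Sb * fromBlocks A C Cᵀ B * (fromBlocks Sa 0 0 Sb)ᵀ) =
        1 / (1 + nuPT (fromBlocks A C Cᵀ B)) := by
  have hpos := hV.posDef
  have hA : A.PosDef := hpos.submatrix Sum.inl_injective
  have hB : B.PosDef := hpos.submatrix Sum.inr_injective
  obtain ⟨P, hP, hPA⟩ := exists_det_one_congr_eq_smul_one hA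
  obtain ⟨Q, hQ, hQB⟩ := exists_det_one_congr_eq_smul_one hB
  rw [← hsym] at hQB
  obtain ⟨R, hR, hRR, hoff, hdiag⟩ := exists_rotation_mul (P * C * Qᵀ)
  have hRP : (R * P).det = 1 := by rw [det_mul, hR, hP, one_mul]
  have hRA : R * P * A * (R * P)ᵀ = √A.det • 1 := by
    calc R * P * A * (R * P)ᵀ = R * (P * A * Pᵀ) * Rᵀ := by
          simp only [transpose_mul, Matrix.mul_assoc]
      _ = √A.det • 1 := by rw [hPA, Matrix.mul_smul, Matrix.mul_one, Matrix.smul_mul, hRR]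
  have hRC : R * (P * C * Qᵀ) = R * P * C * Qᵀ := by simp only [Matrix.mul_assoc]
  rw [hRC] at hoff hdiag
  have hν := nuPT_local_congr A B C hRP hQ
  have hpos' : (fromBlocks (R * P * A * (R * P)ᵀ) (R * P * C * Qᵀ) (R * P * C * Qᵀ)ᵀ
      (Q * B * Qᵀ)).PosDef := by
    rw [← local_congr_fromBlocks, ← conjTranspose_eq_transpose_of_trivial]
    refine hpos.mul_mul_conjTranspose_same (vecMul_injective_of_isUnit ?_)
    rw [isUnit_iff_isUnit_det, det_fromBlocks_zero₂₁, hRP, hQ]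
    simp
  obtain ⟨S, T, hS, hT, hF⟩ := exists_local_fid_eq (posDef_noiseN hpos')
  refine ⟨S * (R * P), T * Q, mul_J2_mul_transpose_eq (by rw [det_mul, hS, hRP, one_mul]),
    mul_J2_mul_transpose_eq (by rw [det_mul, hT, hQ, one_mul]), ?_⟩
  have hνN := sqrt_det_noiseN_eq (q := (R * P * C * Qᵀ) 0 1) (Real.sqrt_pos.2 hA.det_pos) hdiag
  rw [← hoff, ← eta_fin_two (R * P * C * Qᵀ)] at hνN
  have hcomp : fromBlocks (S * (R * P)) 0 0 (T * Q) * fromBlocks A C Cᵀ B *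
      (fromBlocks (S * (R * P)) 0 0 (T * Q))ᵀ =
      fromBlocks (S * (R * P * A * (R * P)ᵀ) * Sᵀ) (S * (R * P * C * Qᵀ) * Tᵀ)
        (S * (R * P * C * Qᵀ) * Tᵀ)ᵀ (T * (Q * B * Qᵀ) * Tᵀ) := by
    rw [local_congr_fromBlocks]
    simp only [transpose_mul, Matrix.mul_assoc]
  rw [hcomp, hF, ← hν, hRA, hQB, hνN]
  have h0 : 0 ≤ nuPT (fromBlocks (√A.det • 1) (R * P * C * Qᵀ) (R * P * C * Qᵀ)ᵀ
      (√A.det • 1)) := Real.sqrt_nonneg _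
  field_simp
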